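/- For every k ≥ 1, 𝔼[|proj_0 𝒟_{k+1}(ω)|] ≤ 𝔼[|proj_0 𝒟_k(ω')|] − 𝔼[|proj_0 𝒯_0^{(k+1)}(ω) ∩ proj_0 𝒯_1^{(k+1)}(ω)|], where ω is an i.i.d. uniform angle tree of height k+1 and ω' one of height k. -/

import Mathlib

open MeasureTheory Real Set

noncomputable section

/-- The uniform probability measure on the interval `[0, π/2]`. -/
def unif : Measure ℝ := (ENNReal.ofReal (π / 2))⁻¹ • volume.restrict (Set.Icc 0 (π / 2))

/-- An angle tree of height `n`: an angle in `ℝ` for every word over `{0,1,2,3}`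
of length `< n`. -/
abbrev AngleTree (n : ℕ) := ∀ k : Fin n, (Fin k → Fin 4) → ℝ

/-- The i.i.d. measure on angle trees of height `n`, each coordinate uniform on `[0, π/2]`. -/
def treeMeasure (n : ℕ) : Measure (AngleTree n) :=
  Measure.pi fun k => Measure.pi fun _ : Fin k → Fin 4 => unif

/-- The centre `c(ω, w)` of the disk indexed by the word `w` of length `n`. -/
def center {n : ℕ} (ω : AngleTree n) (w : Fin n → Fin 4) : ℂ :=
  ∑ k : Fin n, (3 / 4 : ℂ) * (4 : ℂ)⁻¹ ^ (k : ℕ) *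
    Complex.exp (((((w k : ℕ) : ℝ) * (π / 2) -
      ω k (fun i => w (Fin.castLE k.isLt.le i)) : ℝ) : ℂ) * Complex.I)

/-- The `n`-th generation random Cantor disks `𝒟_n(ω)`. -/
def cantorDisks {n : ℕ} (ω : AngleTree n) : Set ℂ :=
  ⋃ w : Fin n → Fin 4, Metric.closedBall (center ω w) ((4 : ℝ)⁻¹ ^ n)

/-- The orthogonal projection of `E ⊆ ℂ` onto the line `ℝ·e^{iθ}`, identified with `ℝ`. -/
def proj (θ : ℝ) (E : Set ℂ) : Set ℝ :=
  (fun z => (Complex.exp (-(θ : ℂ) * Complex.I) * z).re) '' E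

/-- The length of the projection of `E` in direction `θ`. -/
def projLen (θ : ℝ) (E : Set ℂ) : ℝ := (volume (proj θ E)).toReal

/-- The part `𝒯_α^{(k+1)}(ω)` of `𝒟_{k+1}(ω)` consisting of the disks whose word starts
with the letter `α`. -/
def TPart {k : ℕ} (α : Fin 4) (ω : AngleTree (k + 1)) : Set ℂ :=
  ⋃ w ∈ {w : Fin (k + 1) → Fin 4 | w 0 = α},
    Metric.closedBall (center ω w) ((4 : ℝ)⁻¹ ^ (k + 1))

instance : IsProbabilityMeasure unif := by
  refine ⟨?_⟩
  have hπ : 0 < π / 2 := by positivity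
  rw [unif, Measure.smul_apply, Measure.restrict_apply_univ, Real.volume_Icc, sub_zero, smul_eq_mul]
  exact ENNReal.inv_mul_cancel (by simpa using hπ) ENNReal.ofReal_ne_top

instance (n : ℕ) : IsProbabilityMeasure (treeMeasure n) := by
  unfold treeMeasure
  infer_instance

/-- Restricting a finite product of probability measures to the coordinates selected by an
injection gives the product of the selected factors. -/
theorem measurePreserving_pi_comp_injective {ι κ : Type*} [Fintype ι] [Fintype κ]
    {X : ι → Type*} [∀ i, MeasurableSpace (X i)] (μ : ∀ i, Measure (X i))
    [∀ i, IsProbabilityMeasure (μ i)] {f : κ → ι} (hf : f.Injective) :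
    MeasurePreserving (fun (x : ∀ i, X i) j => x (f j)) (Measure.pi μ)
      (Measure.pi fun j => μ (f j)) := by
  refine ⟨by fun_prop, ?_⟩
  have hind := (ProbabilityTheory.iIndepFun_pi (μ := μ) (X := fun _ x => x)
    fun _ => aemeasurable_id).precomp hf
  have hmap := (ProbabilityTheory.iIndepFun_iff_map_fun_eq_pi_map
    fun j => (measurable_pi_apply (f j)).aemeasurable).1 hind
  rw [hmap]
  congr 1
  ext1 j
  exact (measurePreserving_eval μ (f j)).map_eq

/-- The subtree of an angle tree rooted at the first-generation vertex `α`. -/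
def subtree {k : ℕ} (α : Fin 4) (ω : AngleTree (k + 1)) : AngleTree k :=
  fun j u => ω j.succ (Fin.cons (α := fun _ => Fin 4) α u)

theorem measurePreserving_subtree {k : ℕ} (α : Fin 4) :
    MeasurePreserving (subtree (k := k) α) (treeMeasure (k + 1)) (treeMeasure k) := by
  have houter : MeasurePreserving (fun (ω : AngleTree (k + 1)) (j : Fin k) => ω j.succ)
      (treeMeasure (k + 1))
      (Measure.pi fun j : Fin k => Measure.pi fun _ : Fin j.succ → Fin 4 => unif) :=
    measurePreserving_pi_comp_injective
      (fun j : Fin (k + 1) => Measure.pi fun _ : Fin j → Fin 4 => unif) (Fin.succ_injective k)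
  have hinner : MeasurePreserving
      (fun (η : ∀ j : Fin k, (Fin j.succ → Fin 4) → ℝ) (j : Fin k) (u : Fin j → Fin 4) =>
        η j (Fin.cons (α := fun _ => Fin 4) α u))
      (Measure.pi fun j : Fin k => Measure.pi fun _ : Fin j.succ → Fin 4 => unif)
      (treeMeasure k) :=
    measurePreserving_pi (fun j : Fin k => Measure.pi fun _ : Fin j.succ → Fin 4 => unif)
      (fun j : Fin k => Measure.pi fun _ : Fin j → Fin 4 => unif)
      (f := fun j x (u : Fin j → Fin 4) => x (Fin.cons (α := fun _ => Fin 4) α u)) fun j =>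
      measurePreserving_pi_comp_injective (ι := Fin (j + 1 : ℕ) → Fin 4)
        (κ := Fin j → Fin 4) (fun _ => unif)
        (f := fun u : Fin j → Fin 4 => Fin.cons (α := fun _ => Fin 4) α u)
        (Fin.cons_right_injective (α := fun _ => Fin 4) α)
  exact hinner.comp houter

theorem center_cons {k : ℕ} (ω : AngleTree (k + 1)) (α : Fin 4) (u : Fin k → Fin 4) :
    center ω (Fin.cons (α := fun _ => Fin 4) α u) =
      (3 / 4 : ℂ) * Complex.exp (((((α : ℕ) : ℝ) * (π / 2) - ω 0 Fin.elim0 : ℝ) : ℂ) * Complex.I) +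
        (4 : ℂ)⁻¹ * center (subtree α ω) u := by
  unfold _root_.center subtree
  rw [Fin.sum_univ_succ, Finset.mul_sum]
  congr 1
  · have h (g : Fin (0 : Fin (k + 1)) → Fin 4) : ω 0 g = ω 0 Fin.elim0 :=
      congrArg (ω 0) (funext fun i => i.elim0)
    rw [Fin.cons_zero, h]
    simp only [Fin.val_zero, pow_zero, mul_one]
  · refine Finset.sum_congr rfl fun j _ => ?_
    have h : (fun i : Fin j.succ =>
        (Fin.cons α u : Fin (k + 1) → Fin 4) (Fin.castLE j.succ.isLt.le i)) =
        Fin.cons (α := fun _ => Fin 4) α fun i => u (Fin.castLE j.isLt.le i) := by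
      funext i
      refine Fin.cases rfl (fun i => rfl) i
    rw [h, Fin.cons_succ, Fin.val_succ, pow_succ]
    ring

theorem measurable_center_re {n : ℕ} (w : Fin n → Fin 4) :
    Measurable fun ω : AngleTree n => (center ω w).re := by
  unfold _root_.center
  fun_prop

theorem proj_zero_closedBall (c : ℂ) (r : ℝ) :
    proj 0 (Metric.closedBall c r) = Metric.closedBall c.re r := by
  ext x
  simp only [proj, Complex.ofReal_zero, neg_zero, zero_mul, Complex.exp_zero, one_mul, mem_image,
    Metric.mem_closedBall, Real.dist_eq, Complex.dist_eq]
  constructor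
  · rintro ⟨z, hz, rfl⟩
    exact (Complex.abs_re_le_norm (z - c)).trans hz
  · intro hx
    refine ⟨c + ((x - c.re : ℝ) : ℂ), ?_, by simp⟩
    rwa [add_sub_cancel_left, Complex.norm_real, Real.norm_eq_abs]

theorem proj_iUnion {ι : Sort*} (θ : ℝ) (E : ι → Set ℂ) :
    proj θ (⋃ i, E i) = ⋃ i, proj θ (E i) :=
  image_iUnion

theorem proj_cantorDisks {n : ℕ} (ω : AngleTree n) :
    proj 0 (cantorDisks ω) =
      ⋃ w : Fin n → Fin 4, Metric.closedBall (center ω w).re ((4 : ℝ)⁻¹ ^ n) := by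
  simp only [cantorDisks, proj_iUnion, proj_zero_closedBall]

theorem proj_TPart {k : ℕ} (α : Fin 4) (ω : AngleTree (k + 1)) :
    proj 0 (TPart α ω) =
      ⋃ w ∈ {w : Fin (k + 1) → Fin 4 | w 0 = α},
        Metric.closedBall (center ω w).re ((4 : ℝ)⁻¹ ^ (k + 1)) := by
  simp only [TPart, proj_iUnion, proj_zero_closedBall]

theorem cantorDisks_succ {k : ℕ} (ω : AngleTree (k + 1)) :
    cantorDisks ω = ⋃ α, TPart α ω := by
  ext z
  simp [cantorDisks, TPart]

theorem measurableSet_proj_TPart {k : ℕ} (α : Fin 4) (ω : AngleTree (k + 1)) :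
    MeasurableSet (proj 0 (TPart α ω)) := by
  rw [proj_TPart]
  exact (Set.toFinite _).measurableSet_biUnion fun _ _ => measurableSet_closedBall

theorem measurableSet_graph_closedBall {Ω : Type*} [MeasurableSpace Ω] {a : Ω → ℝ}
    (ha : Measurable a) (r : ℝ) :
    MeasurableSet {p : Ω × ℝ | p.2 ∈ Metric.closedBall (a p.1) r} := by
  simp only [Metric.mem_closedBall]
  exact measurableSet_le (by fun_prop) measurable_const

theorem measurableSet_graph_cantorDisks (n : ℕ) :
    MeasurableSet {p : AngleTree n × ℝ | p.2 ∈ proj 0 (cantorDisks p.1)} := by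
  simp only [proj_cantorDisks, mem_iUnion, ofPred_exists]
  exact .iUnion fun w => measurableSet_graph_closedBall (measurable_center_re w) _

theorem measurableSet_graph_TPart (k : ℕ) (α : Fin 4) :
    MeasurableSet {p : AngleTree (k + 1) × ℝ | p.2 ∈ proj 0 (TPart α p.1)} := by
  simp only [proj_TPart, mem_iUnion, ofPred_exists]
  exact .iUnion fun w => .iUnion fun _ =>
    measurableSet_graph_closedBall (measurable_center_re w) _

theorem volume_proj_cantorDisks_le {n : ℕ} (ω : AngleTree n) :
    volume (proj 0 (cantorDisks ω)) ≤
      ∑ _w : Fin n → Fin 4, ENNReal.ofReal (2 * (4 : ℝ)⁻¹ ^ n) := by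
  rw [proj_cantorDisks]
  refine (measure_iUnion_fintype_le _ _).trans_eq ?_
  simp only [Real.volume_closedBall]

/-- A random measurable subset of the projection of `𝒟_n` has integrable length. -/
theorem integrable_volume_of_subset_proj {n : ℕ} (A : AngleTree n → Set ℝ)
    (hA : MeasurableSet {p : AngleTree n × ℝ | p.2 ∈ A p.1})
    (hsub : ∀ ω, A ω ⊆ proj 0 (cantorDisks ω)) :
    Integrable (fun ω => (volume (A ω)).toReal) (treeMeasure n) := by
  have hmeas : Measurable fun ω => volume (A ω) := measurable_measure_prodMk_left hA
  refine Integrable.of_bound hmeas.ennreal_toReal.aestronglyMeasurable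
    (∑ _w : Fin n → Fin 4, ENNReal.ofReal (2 * (4 : ℝ)⁻¹ ^ n)).toReal (.of_forall fun ω => ?_)
  rw [Real.norm_of_nonneg ENNReal.toReal_nonneg]
  exact ENNReal.toReal_mono (by simp [ENNReal.mul_eq_top])
    ((measure_mono (hsub ω)).trans (volume_proj_cantorDisks_le ω))

theorem proj_TPart_subset {k : ℕ} (α : Fin 4) (ω : AngleTree (k + 1)) :
    proj 0 (TPart α ω) ⊆ proj 0 (cantorDisks ω) := by
  rw [cantorDisks_succ]
  exact image_mono (subset_iUnion (fun α => TPart α ω) α)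

theorem volume_proj_TPart_ne_top {k : ℕ} (α : Fin 4) (ω : AngleTree (k + 1)) :
    volume (proj 0 (TPart α ω)) ≠ ⊤ :=
  ne_top_of_le_ne_top (by simp [ENNReal.mul_eq_top])
    ((measure_mono (proj_TPart_subset α ω)).trans (volume_proj_cantorDisks_le ω))

/-- The part of `𝒟_{k+1}` in a first-generation disk is a translate of a copy of the `𝒟_k` of
the corresponding subtree, scaled by `1/4`. -/
theorem projLen_TPart {k : ℕ} (α : Fin 4) (ω : AngleTree (k + 1)) :
    projLen 0 (TPart α ω) = 4⁻¹ * projLen 0 (cantorDisks (subtree α ω)) := by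
  set b : ℝ := ((3 / 4 : ℂ) *
    Complex.exp (((((α : ℕ) : ℝ) * (π / 2) - ω 0 Fin.elim0 : ℝ) : ℂ) * Complex.I)).re with hb
  have hre (u : Fin k → Fin 4) : (center ω (Fin.cons (α := fun _ => Fin 4) α u)).re =
      b + 4⁻¹ * (center (subtree α ω) u).re := by
    have h4 : (4 : ℂ)⁻¹ = ((4⁻¹ : ℝ) : ℂ) := by norm_num
    rw [center_cons, Complex.add_re, hb, h4, Complex.re_ofReal_mul]
  have hset : proj 0 (TPart α ω) =
      (fun x => x - b) ⁻¹' ((4 * ·) ⁻¹' proj 0 (cantorDisks (subtree α ω))) := by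
    have key (x : ℝ) (u : Fin k → Fin 4) :
        x ∈ Metric.closedBall (center ω (Fin.cons (α := fun _ => Fin 4) α u)).re
          ((4 : ℝ)⁻¹ ^ (k + 1)) ↔
        4 * (x - b) ∈ Metric.closedBall (center (subtree α ω) u).re ((4 : ℝ)⁻¹ ^ k) := by
      rw [hre, Metric.mem_closedBall, Metric.mem_closedBall, Real.dist_eq, Real.dist_eq, pow_succ,
        show x - (b + 4⁻¹ * (center (subtree α ω) u).re) =
          (4 * (x - b) - (center (subtree α ω) u).re) * 4⁻¹ by ring, abs_mul,
        abs_of_pos (by norm_num : (0 : ℝ) < 4⁻¹), mul_le_mul_iff_left₀ (by norm_num)]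
    ext x
    simp only [proj_TPart, proj_cantorDisks, mem_preimage, mem_iUnion, mem_ofPred_eq, exists_prop]
    constructor
    · rintro ⟨w, rfl, hw⟩
      refine ⟨Fin.tail w, (key x _).1 ?_⟩
      rwa [Fin.cons_self_tail]
    · rintro ⟨u, hu⟩
      exact ⟨Fin.cons (α := fun _ => Fin 4) α u, Fin.cons_zero .., (key x u).2 hu⟩
  have htrans (s : Set ℝ) : volume ((fun x => x - b) ⁻¹' s) = volume s := by
    simp only [sub_eq_add_neg, measure_preimage_add_right]
  rw [projLen, projLen, hset, htrans,
    Real.volume_preimage_mul_left four_ne_zero, ENNReal.toReal_mul,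
    ENNReal.toReal_ofReal (abs_nonneg _), abs_of_pos (by norm_num)]

theorem integral_projLen_TPart (k : ℕ) (α : Fin 4) :
    ∫ ω, projLen 0 (TPart α ω) ∂(treeMeasure (k + 1)) =
      4⁻¹ * ∫ ω', projLen 0 (cantorDisks ω') ∂(treeMeasure k) := by
  simp only [projLen_TPart, integral_const_mul]
  have hmp := measurePreserving_subtree (k := k) α
  rw [← hmp.map_eq, integral_map hmp.measurable.aemeasurable]
  rw [hmp.map_eq]
  exact (integrable_volume_of_subset_proj _ (measurableSet_graph_cantorDisks k)
    fun _ => Subset.rfl).aestronglyMeasurable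

theorem projLen_cantorDisks_succ_le {k : ℕ} (ω : AngleTree (k + 1)) :
    projLen 0 (cantorDisks ω) ≤
      ∑ α, projLen 0 (TPart α ω) -
        (volume (proj 0 (TPart 0 ω) ∩ proj 0 (TPart 1 ω))).toReal := by
  have hunion : proj 0 (cantorDisks ω) = proj 0 (TPart 0 ω) ∪ proj 0 (TPart 1 ω) ∪
      proj 0 (TPart 2 ω) ∪ proj 0 (TPart 3 ω) := by
    rw [cantorDisks_succ, proj_iUnion]
    ext x
    simp [Fin.exists_fin_succ, or_assoc]
  have h01 := measureReal_union_add_inter (μ := volume) (s := proj 0 (TPart 0 ω))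
    (measurableSet_proj_TPart 1 ω) (volume_proj_TPart_ne_top 0 ω) (volume_proj_TPart_ne_top 1 ω)
  have h2 := measureReal_union_le (μ := volume)
    (proj 0 (TPart 0 ω) ∪ proj 0 (TPart 1 ω)) (proj 0 (TPart 2 ω))
  have h3 := measureReal_union_le (μ := volume)
    (proj 0 (TPart 0 ω) ∪ proj 0 (TPart 1 ω) ∪ proj 0 (TPart 2 ω)) (proj 0 (TPart 3 ω))
  simp only [Measure.real] at h01 h2 h3
  simp only [projLen, hunion, Fin.sum_univ_four]
  linarith

/-- The expected projection length of `𝒟_{k+1}` is at most the expected projection length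
of `𝒟_k` minus the expected overlap of the projections of the index-`0` and index-`1`
parts of `𝒟_{k+1}`. -/
theorem expected_projection_step (k : ℕ) (hk : 1 ≤ k) :
    (∫ ω, projLen 0 (cantorDisks ω) ∂(treeMeasure (k + 1))) ≤
      (∫ ω', projLen 0 (cantorDisks ω') ∂(treeMeasure k)) -
        ∫ ω, (volume (proj 0 (TPart 0 ω) ∩ proj 0 (TPart 1 ω))).toReal
          ∂(treeMeasure (k + 1)) := by
  have hT (α : Fin 4) : Integrable (fun ω => projLen 0 (TPart α ω)) (treeMeasure (k + 1)) :=
    integrable_volume_of_subset_proj _ (measurableSet_graph_TPart k α) (proj_TPart_subset α)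
  have hI : Integrable (fun ω => (volume (proj 0 (TPart 0 ω) ∩ proj 0 (TPart 1 ω))).toReal)
      (treeMeasure (k + 1)) :=
    integrable_volume_of_subset_proj _
      ((measurableSet_graph_TPart k 0).inter (measurableSet_graph_TPart k 1))
      fun ω => inter_subset_left.trans (proj_TPart_subset 0 ω)
  have hD : Integrable (fun ω => projLen 0 (cantorDisks ω)) (treeMeasure (k + 1)) :=
    integrable_volume_of_subset_proj _ (measurableSet_graph_cantorDisks (k + 1))
      fun _ => Subset.rfl
  have hsum : Integrable (fun ω => ∑ α, projLen 0 (TPart α ω)) (treeMeasure (k + 1)) :=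
    integrable_finsetSum _ fun α _ => hT α
  refine (integral_mono hD (hsum.sub hI) projLen_cantorDisks_succ_le).trans_eq ?_
  simp only [Pi.sub_apply]
  rw [integral_sub hsum hI, integral_finsetSum _ fun α _ => hT α]
  simp only [integral_projLen_TPart, Fin.sum_univ_four]
  ring

end
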